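/- arXiv:2103.14707 — 4 statements merged into one kernel-verified Lean document; each statement's English description precedes it below -/
import Mathlib

section
/- Let k ≥ 1 and m ≥ 0, let I be the ideal (ζ̄_{m+1}, …, ζ̄_{m+k}) of A⟨k⟩, and set δ = 2(2^m − 1)(2^k − 1). Then the multiplication pairing between complementary degrees of A⟨k⟩/I is perfect: for every natural number t and every weighted-homogeneous polynomial p of weighted degree t with p ∉ I, there exists a weighted-homogeneous polynomial q of weighted degree δ − t such that p·q ∉ I. -/
open MvPolynomial

/-- The dual Steenrod algebra `A = F₂[ξ₁, ξ₂, …]`; the variable `X i` represents `ξ_{i+1}`. -/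
noncomputable abbrev DualSteenrod : Type := MvPolynomial ℕ (ZMod 2)

/-- The conjugate classes, via Milnor's recursion
`ζ_n = ∑_{i=1}^{n} ξ_i^{2^{n−i}} ζ_{n−i}` (with `ζ_0 = 1`). -/
noncomputable def zeta : ℕ → DualSteenrod
  | 0 => 1
  | (n+1) => ∑ i ∈ Finset.range (n+1), (X i) ^ (2^(n-i)) * zeta (n-i)
  decreasing_by omega

/-- The projection `A → A⟨k⟩ = F₂[ξ₁, …, ξ_k]`, killing `ξ_i` for `i > k`.
In `MvPolynomial (Fin k) (ZMod 2)`, the variable `X i` represents `ξ_{i+1}`. -/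
noncomputable def proj (k : ℕ) :
    DualSteenrod →ₐ[ZMod 2] MvPolynomial (Fin k) (ZMod 2) :=
  aeval (fun i => if h : i < k then X (⟨i, h⟩ : Fin k) else 0)

/-- `ζ̄_n`, the image of `ζ_n` in `A⟨k⟩`. -/
noncomputable def zetaBar (k n : ℕ) : MvPolynomial (Fin k) (ZMod 2) :=
  proj k (zeta n)

/-- Multiplication by `a` is injective modulo the ideal `K`. -/
def IsRegularMod {R : Type*} [CommRing R] (K : Ideal R) (a : R) : Prop :=
  ∀ y, a * y ∈ K → y ∈ K

namespace IsRegularMod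

variable {R : Type*} [CommRing R] {K : Ideal R} {a b : R}

theorem pow (ha : IsRegularMod K a) (n : ℕ) : IsRegularMod K (a ^ n) := by
  induction n with
  | zero => intro y hy; simpa using hy
  | succ n ih =>
    intro y hy
    rw [pow_succ, mul_assoc] at hy
    exact ha _ (ih _ hy)

theorem mul (ha : IsRegularMod K a) (hb : IsRegularMod K b) : IsRegularMod K (a * b) := by
  intro y hy
  rw [mul_assoc] at hy
  exact hb _ (ha _ hy)

theorem congr (ha : IsRegularMod K a) (hab : b - a ∈ K) : IsRegularMod K b := by
  intro y hy
  refine ha y ?_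
  have h := K.sub_mem hy (K.mul_mem_right y hab)
  rwa [← sub_mul, sub_sub_cancel] at h

theorem swap (ha : IsRegularMod K a) (hb : IsRegularMod (Ideal.span {a} ⊔ K) b) :
    IsRegularMod (Ideal.span {b} ⊔ K) a := by
  intro y hy
  obtain ⟨c, d, hd, h⟩ := Ideal.mem_span_singleton_sup.mp hy
  have hc : c ∈ Ideal.span {a} ⊔ K := by
    refine hb c (Ideal.mem_span_singleton_sup.mpr ⟨y, -d, K.neg_mem hd, ?_⟩)
    linear_combination -h
  obtain ⟨e, f, hf, h'⟩ := Ideal.mem_span_singleton_sup.mp hc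
  have hye : y - e * b ∈ K := by
    refine ha _ ?_
    have : a * (y - e * b) = d + b * f := by linear_combination -h - b * h'
    rw [this]
    exact K.add_mem hd (K.mul_mem_left _ hf)
  exact Ideal.mem_span_singleton_sup.mpr ⟨e, _, hye, by ring⟩

open DirectSum in
/-- A graded Nakayama argument: regularity modulo `(a) + K` descends to regularity modulo `K`
when `a` is regular modulo `K` of positive degree. -/
theorem of_sup {σ : Type*} [SetLike σ R] [AddSubgroupClass σ R] {𝒜 : ℕ → σ} [GradedRing 𝒜]
    (hK : K.IsHomogeneous 𝒜) {d e : ℕ} (hd : 0 < d) (had : a ∈ 𝒜 d) (hbe : b ∈ 𝒜 e)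
    (ha : IsRegularMod K a) (hb : IsRegularMod (Ideal.span {a} ⊔ K) b) :
    IsRegularMod K b := by
  have key : ∀ n : ℕ, ∀ y ∈ 𝒜 n, b * y ∈ K → y ∈ K := by
    intro n
    induction n using Nat.strong_induction_on with
    | _ n ih =>
      intro y hyn hy
      obtain ⟨c, f, hf, h⟩ :=
        Ideal.mem_span_singleton_sup.mp (hb y (Ideal.mem_sup_right hy))
      have hn : (decompose 𝒜 (a * c) n : R) + decompose 𝒜 f n = y := by
        rw [← decompose_of_mem_same 𝒜 hyn, ← h, decompose_add, mul_comm c a]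
        rfl
      have hfn : (decompose 𝒜 f n : R) ∈ K := hK n hf
      rw [← hn]
      refine K.add_mem ?_ hfn
      by_cases hdn : d ≤ n
      · rw [coe_decompose_mul_of_left_mem_of_le 𝒜 had hdn] at hn ⊢
        refine K.mul_mem_left _ (ih (n - d) (by omega) _ (SetLike.coe_mem _) (ha _ ?_))
        have : a * (b * (decompose 𝒜 c (n - d) : R)) = b * y - b * decompose 𝒜 f n := by
          linear_combination b * hn
        rw [this]
        exact K.sub_mem hy (K.mul_mem_left _ hfn)
      · rw [coe_decompose_mul_of_left_mem_of_not_le 𝒜 had hdn]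
        exact K.zero_mem
  intro y hy
  rw [hK.mem_iff]
  intro n
  refine key n _ (SetLike.coe_mem _) ?_
  rw [← coe_decompose_mul_add_of_left_mem 𝒜 hbe]
  exact hK _ hy

end IsRegularMod

/-- Elements `x 0, …, x (k - 1)` forming a regular sequence (read from the end) of the degrees
of `ξ₁, …, ξ_k` in a graded ring, together with the elements `z n` that Milnor's recursion
attaches to them. -/
structure IsMilnorSystem {R σ : Type*} [CommRing R] [SetLike σ R] [AddSubgroupClass σ R]
    (𝒜 : ℕ → σ) [GradedRing 𝒜] (k : ℕ) (x z : ℕ → R) : Prop where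
  zero : z 0 = 1
  succ (n : ℕ) : z (n + 1) = ∑ i ∈ Finset.range (n + 1), x i ^ 2 ^ (n - i) * z (n - i)
  mem (i : ℕ) : x i ∈ 𝒜 (2 ^ (i + 1) - 1)
  regular (r : ℕ) (hr : r < k) : IsRegularMod (Ideal.span (x '' Set.Ici (r + 1))) (x r)

/-- The ideal generated by the `x i` with `r ≤ i` and the `z i` with `a ≤ i < b`. -/
def milnorIdeal {R : Type*} [CommRing R] (x z : ℕ → R) (r a b : ℕ) : Ideal R :=
  Ideal.span (x '' Set.Ici r ∪ z '' Set.Ico a b)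

section milnorIdeal

variable {R : Type*} [CommRing R] {x z : ℕ → R} {r a b : ℕ}

theorem x_mem_milnorIdeal {i : ℕ} (hi : r ≤ i) : x i ∈ milnorIdeal x z r a b :=
  Ideal.subset_span (Or.inl ⟨i, hi, rfl⟩)

theorem z_mem_milnorIdeal {i : ℕ} (ha : a ≤ i) (hb : i < b) : z i ∈ milnorIdeal x z r a b :=
  Ideal.subset_span (Or.inr ⟨i, ⟨ha, hb⟩, rfl⟩)

theorem milnorIdeal_le {K : Ideal R} (hx : ∀ i, r ≤ i → x i ∈ K)
    (hz : ∀ i, a ≤ i → i < b → z i ∈ K) : milnorIdeal x z r a b ≤ K := by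
  refine Ideal.span_le.mpr ?_
  rintro _ (⟨i, hi, rfl⟩ | ⟨i, hi, rfl⟩)
  · exact hx i hi
  · exact hz i hi.1 hi.2

theorem milnorIdeal_eq_span_x_sup :
    milnorIdeal x z r a b = Ideal.span {x r} ⊔ milnorIdeal x z (r + 1) a b := by
  rw [milnorIdeal, milnorIdeal, ← Ideal.span_insert, ← Set.insert_union, ← Set.image_insert_eq]
  congr 3
  ext i
  simp only [Set.mem_Ici, Set.mem_insert_iff]
  omega

theorem milnorIdeal_eq_span_left_sup (h : a < b) :
    milnorIdeal x z r a b = Ideal.span {z a} ⊔ milnorIdeal x z r (a + 1) b := by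
  rw [milnorIdeal, milnorIdeal, ← Ideal.span_insert, ← Set.union_insert, ← Set.image_insert_eq]
  congr 3
  ext i
  simp only [Set.mem_Ico, Set.mem_insert_iff]
  omega

theorem milnorIdeal_eq_span_right_sup (h : a ≤ b) :
    milnorIdeal x z r a (b + 1) = Ideal.span {z b} ⊔ milnorIdeal x z r a b := by
  rw [milnorIdeal, milnorIdeal, ← Ideal.span_insert, ← Set.union_insert, ← Set.image_insert_eq]
  congr 3
  ext i
  simp only [Set.mem_Ico, Set.mem_insert_iff]
  omega

end milnorIdeal

namespace IsMilnorSystem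

variable {R σ : Type*} [CommRing R] [SetLike σ R] [AddSubgroupClass σ R]
  {𝒜 : ℕ → σ} [GradedRing 𝒜] {k : ℕ} {x z : ℕ → R}

theorem z_mem (h : IsMilnorSystem 𝒜 k x z) (n : ℕ) : z n ∈ 𝒜 (2 ^ n - 1) := by
  induction n using Nat.strong_induction_on with
  | _ n ih =>
    cases n with
    | zero => rw [h.zero]; exact SetLike.one_mem_graded 𝒜
    | succ n =>
      rw [h.succ]
      refine sum_mem fun i hi => ?_
      have hin : i ≤ n := by have := Finset.mem_range.mp hi; omega
      have hmem := SetLike.mul_mem_graded (SetLike.pow_mem_graded (2 ^ (n - i)) (h.mem i))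
        (ih (n - i) (by omega))
      convert! hmem using 2
      have h1 : 2 ^ (n + 1) = 2 ^ (n - i) * 2 ^ (i + 1) := by
        rw [← pow_add]; congr 1; omega
      have h2 : 1 ≤ 2 ^ (i + 1) := Nat.one_le_two_pow
      have h3 : 1 ≤ 2 ^ (n - i) := Nat.one_le_two_pow
      have h4 : 2 ^ (n - i) ≤ 2 ^ (n - i) * 2 ^ (i + 1) := Nat.le_mul_of_pos_right _ h2
      rw [smul_eq_mul, Nat.mul_sub, mul_one, h1]
      omega

theorem isHomogeneous (h : IsMilnorSystem 𝒜 k x z) (r a b : ℕ) :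
    (milnorIdeal x z r a b).IsHomogeneous 𝒜 := by
  refine Ideal.homogeneous_span 𝒜 _ ?_
  rintro _ (⟨i, -, rfl⟩ | ⟨i, -, rfl⟩)
  · exact ⟨_, h.mem i⟩
  · exact ⟨_, h.z_mem i⟩

/-- Modulo `x (r + 1), …` and `z (n + 1), …, z (n + r)`, Milnor's recursion for `z (n + r + 1)`
has only one term. -/
theorem z_sub_mem (h : IsMilnorSystem 𝒜 k x z) (r n : ℕ) :
    z (n + r + 1) - x r ^ 2 ^ n * z n ∈ milnorIdeal x z (r + 1) (n + 1) (n + r + 1) := by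
  have hr : r ∈ Finset.range (n + r + 1) := Finset.mem_range.mpr (by omega)
  rw [h.succ, ← Finset.add_sum_erase _ _ hr, Nat.add_sub_cancel, add_sub_cancel_left]
  refine sum_mem fun i hi => ?_
  rw [Finset.mem_erase, Finset.mem_range] at hi
  rcases lt_or_gt_of_ne hi.1 with hlt | hgt
  · exact Ideal.mul_mem_left _ _ (z_mem_milnorIdeal (by omega) (by omega))
  · exact Ideal.mul_mem_right _ _
      (Ideal.pow_mem_of_mem _ (x_mem_milnorIdeal hgt) _ (by positivity))

theorem milnorIdeal_succ (h : IsMilnorSystem 𝒜 k x z) (r n : ℕ) :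
    milnorIdeal x z (r + 1) (n + 1) (n + r + 2) =
      Ideal.span {x r ^ 2 ^ n * z n} ⊔ milnorIdeal x z (r + 1) (n + 1) (n + r + 1) := by
  have hmem := h.z_sub_mem r n
  rw [milnorIdeal_eq_span_right_sup (by omega)]
  refine le_antisymm (sup_le ?_ le_sup_right) (sup_le ?_ le_sup_right) <;>
    rw [Ideal.span_singleton_le_iff_mem, Ideal.mem_span_singleton_sup]
  · exact ⟨1, _, hmem, by ring⟩
  · exact ⟨1, _, neg_mem hmem, by ring⟩

/-- If consecutive `z`'s are regular modulo `x r, …`, then `x r` is regular modulo fewer of the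
`x`'s and the same `z`'s. -/
theorem x_regular_of_z_regular (h : IsMilnorSystem 𝒜 k x z) {r : ℕ} (hr : r < k)
    (hz : ∀ n j, j < r → IsRegularMod (milnorIdeal x z r (n + 1) (n + 1 + j)) (z n))
    (n j : ℕ) (hj : j ≤ r) : IsRegularMod (milnorIdeal x z (r + 1) n (n + j)) (x r) := by
  induction j generalizing n with
  | zero => simpa [milnorIdeal] using h.regular r hr
  | succ j ih =>
    rw [milnorIdeal_eq_span_left_sup (by omega), show n + (j + 1) = n + 1 + j by omega]
    refine (ih (n + 1) (by omega)).swap ?_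
    rw [← milnorIdeal_eq_span_x_sup]
    exact hz n j (by omega)

theorem z_regular (h : IsMilnorSystem 𝒜 k x z) {r : ℕ} (hr : r ≤ k) (n j : ℕ) (hj : j < r) :
    IsRegularMod (milnorIdeal x z r (n + 1) (n + 1 + j)) (z n) := by
  induction r generalizing n j with
  | zero => omega
  | succ r ihr =>
    have hz := ihr (by omega)
    have hx := h.x_regular_of_z_regular hr hz
    have short : ∀ n j, j < r →
        IsRegularMod (milnorIdeal x z (r + 1) (n + 1) (n + 1 + j)) (z n) := by
      intro n j hj
      refine .of_sup (h.isHomogeneous _ _ _) ?_ (h.mem r) (h.z_mem n) (hx _ _ (by omega)) ?_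
      · have : 2 ^ 1 ≤ 2 ^ (r + 1) := Nat.pow_le_pow_right (by norm_num) (by omega)
        omega
      · rw [← milnorIdeal_eq_span_x_sup]
        exact hz n j hj
    rcases Nat.lt_succ_iff_lt_or_eq.mp hj with hjr | rfl
    · exact short n j hjr
    induction n with
    | zero => intro y hy; simpa [h.zero] using hy
    | succ n ihn =>
      have hnext : IsRegularMod (milnorIdeal x z (j + 1) (n + 1) (n + j + 1)) (z (n + j + 1)) := by
        refine IsRegularMod.congr (IsRegularMod.mul (.pow ?_ _) ?_) (h.z_sub_mem j n)
        · simpa only [Nat.add_right_comm] using hx (n + 1) j le_rfl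
        · simpa only [Nat.add_right_comm] using ihn
      cases j with
      | zero => simpa [milnorIdeal] using hnext
      | succ s =>
        have hs := short (n + 1) s (by omega)
        rw [milnorIdeal_eq_span_left_sup (by omega)] at hnext
        have e : n + (s + 1) + 1 = n + 1 + 1 + s := by omega
        rw [e] at hnext
        rw [← Nat.add_assoc (n + 1 + 1) s 1, milnorIdeal_eq_span_right_sup (by omega)]
        exact hs.swap hnext

theorem x_regular (h : IsMilnorSystem 𝒜 k x z) {r : ℕ} (hr : r < k) (n j : ℕ) (hj : j ≤ r) :
    IsRegularMod (milnorIdeal x z (r + 1) n (n + j)) (x r) :=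
  h.x_regular_of_z_regular hr (fun n j hj => h.z_regular hr.le n j hj) n j hj

theorem x_mem_radical (h : IsMilnorSystem 𝒜 k x z) (r n i : ℕ) :
    x i ∈ (milnorIdeal x z r n (n + r)).radical := by
  induction r generalizing n i with
  | zero => exact Ideal.le_radical (x_mem_milnorIdeal i.zero_le)
  | succ r ihr =>
    have hxr : x r ∈ (milnorIdeal x z (r + 1) n (n + (r + 1))).radical := by
      induction n with
      | zero =>
        have h1 : (1 : R) ∈ milnorIdeal x z (r + 1) 0 (0 + (r + 1)) := by
          rw [← h.zero]
          exact z_mem_milnorIdeal le_rfl (by omega)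
        rw [(Ideal.eq_top_iff_one _).mpr h1, Ideal.radical_top]
        trivial
      | succ n ihn =>
        obtain ⟨N, hN⟩ := ihn
        have hle : milnorIdeal x z (r + 1) n (n + (r + 1)) =
            Ideal.span {z n} ⊔ milnorIdeal x z (r + 1) (n + 1) (n + r + 1) :=
          milnorIdeal_eq_span_left_sup (by omega)
        rw [hle] at hN
        obtain ⟨c, d, hd, hcd⟩ := Ideal.mem_span_singleton_sup.mp hN
        refine ⟨2 ^ n + N, ?_⟩
        have e : n + 1 + (r + 1) = n + r + 2 := by omega
        rw [e, h.milnorIdeal_succ, pow_add, Ideal.mem_span_singleton_sup]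
        exact ⟨c, _, Ideal.mul_mem_left _ (x r ^ 2 ^ n) hd, by rw [← hcd]; ring⟩
    have hle : milnorIdeal x z r n (n + r) ≤
        (milnorIdeal x z (r + 1) n (n + (r + 1))).radical := by
      rw [milnorIdeal_eq_span_x_sup, sup_le_iff, Ideal.span_singleton_le_iff_mem]
      refine ⟨hxr, le_trans (milnorIdeal_le ?_ ?_) Ideal.le_radical⟩
      · exact fun i hi => x_mem_milnorIdeal hi
      · exact fun i h1 h2 => z_mem_milnorIdeal h1 (by omega)
    have := Ideal.radical_mono hle (ihr n i)
    rwa [Ideal.radical_idem] at this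

theorem z_mem_span_x (h : IsMilnorSystem 𝒜 k x z) (n : ℕ) :
    z (n + 1) ∈ Ideal.span (Set.range x) := by
  rw [h.succ]
  exact sum_mem fun i _ => Ideal.mul_mem_right _ _
    (Ideal.pow_mem_of_mem _ (Ideal.subset_span (Set.mem_range_self i)) _ (by positivity))

theorem span_x_le (h : IsMilnorSystem 𝒜 k x z) (r : ℕ) :
    Ideal.span (Set.range x) ≤ milnorIdeal x z r 1 (r + 1) := by
  rw [Ideal.span_le]
  rintro _ ⟨i, rfl⟩
  rcases le_or_gt r i with hi | hi
  · exact x_mem_milnorIdeal hi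
  · have hz : z (i + 1) ∈ milnorIdeal x z r 1 (r + 1) := z_mem_milnorIdeal (by omega) (by omega)
    rw [h.succ, Finset.sum_range_succ, Nat.sub_self, h.zero, pow_zero, pow_one, mul_one] at hz
    refine (Ideal.add_mem_iff_right _ (sum_mem fun l hl => ?_)).mp hz
    have hl := Finset.mem_range.mp hl
    exact Ideal.mul_mem_left _ _ (z_mem_milnorIdeal (by omega) (by omega))

/-- If all `x i` annihilate `y` modulo the ideal with index `n + 2`, then `y` comes from an
element that all `x i` annihilate modulo the ideal with index `n + 1`. -/
theorem exists_of_socle_succ (h : IsMilnorSystem 𝒜 k x z) {r : ℕ} (hr : r < k) (n : ℕ) {y : R}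
    (hy : ∀ i, x i * y ∈ milnorIdeal x z (r + 1) (n + 2) (n + r + 3)) :
    ∃ c, (∀ i, x i * c ∈ milnorIdeal x z (r + 1) (n + 1) (n + r + 2)) ∧
      y - x r ^ 2 ^ (n + 1) * c ∈ milnorIdeal x z (r + 1) (n + 2) (n + r + 2) := by
  have hsucc := h.milnorIdeal_succ r (n + 1)
  rw [show n + 1 + r + 2 = n + r + 3 by omega, show n + 1 + r + 1 = n + r + 2 by omega] at hsucc
  have hI : milnorIdeal x z (r + 1) (n + 1) (n + r + 2) =
      Ideal.span {z (n + 1)} ⊔ milnorIdeal x z (r + 1) (n + 2) (n + r + 2) :=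
    milnorIdeal_eq_span_left_sup (by omega)
  have hx : IsRegularMod (milnorIdeal x z (r + 1) (n + 2) (n + r + 2)) (x r) := by
    have := h.x_regular hr (n + 2) r le_rfl
    rwa [show n + 2 + r = n + r + 2 by omega] at this
  have hz : IsRegularMod (milnorIdeal x z (r + 1) (n + 2) (n + r + 2)) (z (n + 1)) := by
    have := h.z_regular hr (n + 1) r (by omega)
    rwa [show n + 1 + 1 + r = n + r + 2 by omega] at this
  rw [hsucc] at hy
  rw [hI]
  generalize milnorIdeal x z (r + 1) (n + 2) (n + r + 2) = J at hx hz hy ⊢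
  obtain ⟨N, hN⟩ : ∃ N, 2 ^ (n + 1) = N + 1 := ⟨2 ^ (n + 1) - 1, by
    have : 1 ≤ 2 ^ (n + 1) := Nat.one_le_two_pow
    omega⟩
  rw [hN] at hy ⊢
  obtain ⟨a, j, hj, haj⟩ := Ideal.mem_span_singleton_sup.mp (hy r)
  have hya : y - x r ^ N * z (n + 1) * a ∈ J := by
    refine hx _ ?_
    have : x r * (y - x r ^ N * z (n + 1) * a) = j := by
      rw [pow_succ] at haj; linear_combination -haj
    rwa [this]
  have hxa : ∀ i, x i * a ∈ Ideal.span {x r} ⊔ J := by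
    intro i
    obtain ⟨b, j', hj', hb⟩ := Ideal.mem_span_singleton_sup.mp (hy i)
    refine Ideal.mem_span_singleton_sup.mpr ⟨b, x i * a - b * x r, ?_, by ring⟩
    refine ((hx.pow N).mul hz) _ ?_
    have : x r ^ N * z (n + 1) * (x i * a - b * x r) =
        j' - x i * (y - x r ^ N * z (n + 1) * a) := by
      rw [pow_succ] at hb; linear_combination -hb
    rw [this]
    exact J.sub_mem hj' (J.mul_mem_left _ hya)
  have hza : z (n + 1) * a ∈ Ideal.span {x r} ⊔ J := by
    have hzx := h.z_mem_span_x n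
    generalize z (n + 1) = u at hzx
    induction hzx using Submodule.span_induction with
    | mem _ hu => obtain ⟨i, rfl⟩ := hu; exact hxa i
    | zero => rw [zero_mul]; exact Ideal.zero_mem _
    | add u v _ _ hu hv => rw [add_mul]; exact Ideal.add_mem _ hu hv
    | smul c u _ hu => rw [smul_eq_mul, mul_assoc]; exact Ideal.mul_mem_left _ _ hu
  obtain ⟨c, j', hj', hc⟩ := Ideal.mem_span_singleton_sup.mp hza
  have hyc : y - x r ^ (N + 1) * c ∈ J := by
    have : y - x r ^ (N + 1) * c = y - x r ^ N * z (n + 1) * a + x r ^ N * j' := by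
      rw [pow_succ]; linear_combination -x r ^ N * hc
    rw [this]
    exact J.add_mem hya (J.mul_mem_left _ hj')
  refine ⟨c, fun i => ?_, hyc⟩
  obtain ⟨b, j'', hj'', hb⟩ := Ideal.mem_span_singleton_sup.mp (hy i)
  refine Ideal.mem_span_singleton_sup.mpr ⟨b, x i * c - b * z (n + 1), ?_, by ring⟩
  refine hx.pow (N + 1) _ ?_
  have : x r ^ (N + 1) * (x i * c - b * z (n + 1)) = j'' - x i * (y - x r ^ (N + 1) * c) := by
    linear_combination -hb
  rw [this]
  exact J.sub_mem hj'' (J.mul_mem_left _ hyc)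

/-- The socle of the quotient by `z (n + 1), …, z (n + r + 1)` is generated over degree zero by a
power of `x r`. -/
theorem exists_sub_mem_of_socle (h : IsMilnorSystem 𝒜 k x z)
    (h0 : ∀ y, ∃ c ∈ 𝒜 0, y - c ∈ Ideal.span (Set.range x)) {r : ℕ} (hr : r < k) (n : ℕ) {y : R}
    (hy : ∀ i, x i * y ∈ milnorIdeal x z (r + 1) (n + 1) (n + r + 2)) :
    ∃ c ∈ 𝒜 0, y - c * x r ^ (2 * (2 ^ n - 1)) ∈
      milnorIdeal x z (r + 1) (n + 1) (n + r + 2) := by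
  induction n generalizing y with
  | zero =>
    obtain ⟨c, hc, hyc⟩ := h0 y
    have hle := h.span_x_le (r + 1)
    rw [show r + 1 + 1 = 0 + r + 2 by omega] at hle
    exact ⟨c, hc, by simpa using hle hyc⟩
  | succ n ih =>
    rw [show n + 1 + r + 2 = n + r + 3 by omega] at hy ⊢
    obtain ⟨y', hy', hyy'⟩ := h.exists_of_socle_succ hr n hy
    obtain ⟨c, hc, hcy⟩ := ih hy'
    refine ⟨c, hc, ?_⟩
    have hsucc := h.milnorIdeal_succ r (n + 1)
    rw [show n + 1 + r + 2 = n + r + 3 by omega, show n + 1 + r + 1 = n + r + 2 by omega] at hsucc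
    rw [milnorIdeal_eq_span_left_sup (by omega)] at hcy
    obtain ⟨b, j, hj, hb⟩ := Ideal.mem_span_singleton_sup.mp hcy
    rw [hsucc]
    refine Ideal.mem_span_singleton_sup.mpr ⟨b, _, Ideal.add_mem _ hyy'
      (Ideal.mul_mem_left _ (x r ^ 2 ^ (n + 1)) hj), ?_⟩
    have e : 2 * (2 ^ (n + 1) - 1) = 2 ^ (n + 1) + 2 * (2 ^ n - 1) := by
      have : 1 ≤ 2 ^ n := Nat.one_le_two_pow
      rw [pow_succ]
      omega
    rw [e, pow_add]
    linear_combination x r ^ 2 ^ (n + 1) * hb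

/-- A homogeneous element killed modulo `I` by a power of the ideal of the `x i` has a homogeneous
multiple representing a nonzero socle element. -/
theorem exists_socle_multiple (h : IsMilnorSystem 𝒜 k x z) {I : Ideal R} (N : ℕ) {p : R}
    (hp : p ∉ I) (hN : ∀ c ∈ Ideal.span (Set.range x) ^ N, c * p ∈ I) :
    ∃ s, ∃ q ∈ 𝒜 s, p * q ∉ I ∧ ∀ i, x i * (p * q) ∈ I := by
  induction N generalizing p with
  | zero => exact absurd (by simpa using hN 1 (by simp)) hp
  | succ N ih =>
    by_cases hx : ∀ i, x i * p ∈ I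
    · exact ⟨0, 1, SetLike.one_mem_graded 𝒜, by simpa using hp, by simpa using hx⟩
    · push Not at hx
      obtain ⟨i, hi⟩ := hx
      obtain ⟨s, q, hq, hpq, hsoc⟩ := ih hi fun c hc => by
        rw [← mul_assoc]
        exact hN _ (by
          rw [pow_succ]
          exact Ideal.mul_mem_mul hc (Ideal.subset_span ⟨i, rfl⟩))
      have e : p * (x i * q) = x i * p * q := by ring
      refine ⟨_, x i * q, SetLike.mul_mem_graded (h.mem i) hq, ?_, ?_⟩ <;> rw [e]
      exacts [hpq, hsoc]

open DirectSum in
theorem exists_mul_notMem [IsNoetherianRing R] (h : IsMilnorSystem 𝒜 k x z)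
    (h0 : ∀ y, ∃ c ∈ 𝒜 0, y - c ∈ Ideal.span (Set.range x)) {r : ℕ} (hr : r < k) (n : ℕ)
    {t : ℕ} {p : R} (hpt : p ∈ 𝒜 t)
    (hp : p ∉ milnorIdeal x z (r + 1) (n + 1) (n + r + 2)) :
    ∃ s, t + s = 2 * (2 ^ n - 1) * (2 ^ (r + 1) - 1) ∧
      ∃ q ∈ 𝒜 s, p * q ∉ milnorIdeal x z (r + 1) (n + 1) (n + r + 2) := by
  have hrad : Ideal.span (Set.range x) ≤
      (milnorIdeal x z (r + 1) (n + 1) (n + r + 2)).radical := by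
    rw [Ideal.span_le]
    rintro _ ⟨i, rfl⟩
    have := h.x_mem_radical (r + 1) (n + 1) i
    rwa [show n + 1 + (r + 1) = n + r + 2 by omega] at this
  obtain ⟨N, hN⟩ := Ideal.exists_pow_le_of_le_radical_of_fg hrad (IsNoetherian.noetherian _)
  obtain ⟨s, q, hq, hpq, hsoc⟩ :=
    h.exists_socle_multiple N hp fun c hc => Ideal.mul_mem_right _ _ (hN hc)
  refine ⟨s, ?_, q, hq, hpq⟩
  obtain ⟨c, hc, hmem⟩ := h.exists_sub_mem_of_socle h0 hr n hsoc
  by_contra hne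
  have hdeg := SetLike.mul_mem_graded hc
    (SetLike.pow_mem_graded (2 * (2 ^ n - 1)) (h.mem r))
  rw [zero_add, smul_eq_mul] at hdeg
  have hcomp := h.isHomogeneous (r + 1) (n + 1) (n + r + 2) (t + s) hmem
  rw [decompose_sub, DirectSum.sub_apply, AddSubgroupClass.coe_sub,
    decompose_of_mem_same 𝒜 (SetLike.mul_mem_graded hpt hq),
    decompose_of_mem_ne 𝒜 hdeg (Ne.symm hne), sub_zero] at hcomp
  exact hpq hcomp

end IsMilnorSystem

/-- The image of `ξ_{i+1}` in `A⟨k⟩`. -/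
noncomputable def xiBar (k i : ℕ) : MvPolynomial (Fin k) (ZMod 2) :=
  if h : i < k then X ⟨i, h⟩ else 0

theorem zetaBar_zero (k : ℕ) : zetaBar k 0 = 1 := by
  simp [zetaBar, zeta]

theorem zetaBar_succ (k n : ℕ) : zetaBar k (n + 1) =
    ∑ i ∈ Finset.range (n + 1), xiBar k i ^ 2 ^ (n - i) * zetaBar k (n - i) := by
  simp [zetaBar, zeta, proj, xiBar]

theorem span_xiBar_image (k : ℕ) (s : Set ℕ) :
    Ideal.span (xiBar k '' s) = Ideal.span (X '' {i : Fin k | (i : ℕ) ∈ s}) := by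
  refine le_antisymm ?_ (Ideal.span_mono ?_)
  · rw [Ideal.span_le]
    rintro _ ⟨i, hi, rfl⟩
    unfold xiBar
    split_ifs with h
    · exact Ideal.subset_span ⟨⟨i, h⟩, hi, rfl⟩
    · exact Ideal.zero_mem _
  · rintro _ ⟨i, hi, rfl⟩
    exact ⟨i, hi, by simp [xiBar]⟩

theorem xiBar_isRegularMod (k r : ℕ) (hr : r < k) :
    IsRegularMod (Ideal.span (xiBar k '' Set.Ici (r + 1))) (xiBar k r) := by
  intro y hy
  rw [span_xiBar_image, mem_ideal_span_X_image] at hy ⊢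
  intro m hm
  rw [xiBar, dif_pos hr] at hy
  obtain ⟨i, hi, hne⟩ := hy (Finsupp.single ⟨r, hr⟩ 1 + m) (by
    rw [support_X_mul]
    exact Finset.mem_map.mpr ⟨m, hm, rfl⟩)
  refine ⟨i, hi, ?_⟩
  have hir : (⟨r, hr⟩ : Fin k) ≠ i := by
    rintro rfl
    simp at hi
  simpa [Finsupp.single_eq_of_ne' hir] using hne

theorem sub_C_constantCoeff_mem_span_xiBar (k : ℕ) (y : MvPolynomial (Fin k) (ZMod 2)) :
    y - C (constantCoeff y) ∈ Ideal.span (Set.range (xiBar k)) := by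
  rw [← Set.image_univ, span_xiBar_image, mem_ideal_span_X_image]
  intro m hm
  by_contra! hne
  have hm0 : m = 0 := Finsupp.ext fun i => hne i trivial
  simp [hm0, constantCoeff_eq] at hm

attribute [local instance] weightedGradedAlgebra in
theorem isMilnorSystem_zetaBar (k : ℕ) :
    IsMilnorSystem (weightedHomogeneousSubmodule (ZMod 2) fun i : Fin k => 2 ^ ((i : ℕ) + 1) - 1)
      k (xiBar k) (zetaBar k) where
  zero := zetaBar_zero k
  succ := zetaBar_succ k
  mem i := by
    unfold xiBar
    split_ifs with h
    · exact isWeightedHomogeneous_X _ _ _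
    · exact Submodule.zero_mem _
  regular := xiBar_isRegularMod k

theorem milnorIdeal_zetaBar (k n : ℕ) :
    milnorIdeal (xiBar k) (zetaBar k) k (n + 1) (n + 1 + k) =
      Ideal.span (Set.range fun i : Fin k => zetaBar k (n + 1 + (i : ℕ))) := by
  refine le_antisymm (milnorIdeal_le ?_ ?_) (Ideal.span_le.mpr ?_)
  · intro i hi
    rw [xiBar, dif_neg (by omega)]
    exact Ideal.zero_mem _
  · intro i h1 h2
    exact Ideal.subset_span ⟨⟨i - (n + 1), by omega⟩, by simp; congr 1; omega⟩
  · rintro _ ⟨i, rfl⟩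
    exact z_mem_milnorIdeal (by omega) (by omega)

/-- STATEMENT 10: Poincaré duality for `A⟨k⟩/(ζ̄_{m+1}, …, ζ̄_{m+k})`: with
`δ = 2(2^m − 1)(2^k − 1)`, for every `t` and every weighted-homogeneous `p` of
weighted degree `t` with `p ∉ I` there is a weighted-homogeneous `q` of
weighted degree `δ − t` with `p·q ∉ I`. -/
theorem quotient_zetaBar_perfect_pairing (k m : ℕ) (hk : 1 ≤ k)
    (w : Fin k → ℕ) (hw : w = fun i : Fin k => 2 ^ ((i : ℕ) + 1) - 1)
    (I : Ideal (MvPolynomial (Fin k) (ZMod 2)))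
    (hI : I = Ideal.span (Set.range fun i : Fin k => zetaBar k (m + 1 + (i : ℕ))))
    (δ : ℕ) (hδ : δ = 2 * (2 ^ m - 1) * (2 ^ k - 1)) :
    ∀ (t : ℕ) (p : MvPolynomial (Fin k) (ZMod 2)),
      MvPolynomial.IsWeightedHomogeneous w p t → p ∉ I →
        ∃ q : MvPolynomial (Fin k) (ZMod 2),
          MvPolynomial.IsWeightedHomogeneous w q (δ - t) ∧ p * q ∉ I := by
  subst hw hI hδ
  intro t p hpt hp
  obtain ⟨r, rfl⟩ : ∃ r, k = r + 1 := ⟨k - 1, by omega⟩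
  let := weightedGradedAlgebra (ZMod 2) fun i : Fin (r + 1) => 2 ^ ((i : ℕ) + 1) - 1
  have hI := milnorIdeal_zetaBar (r + 1) m
  rw [show m + 1 + (r + 1) = m + r + 2 by omega] at hI
  rw [← hI] at hp ⊢
  obtain ⟨s, hs, q, hq, hpq⟩ := (isMilnorSystem_zetaBar (r + 1)).exists_mul_notMem
    (fun y => ⟨_, isWeightedHomogeneous_C _ _, sub_C_constantCoeff_mem_span_xiBar _ y⟩)
    (Nat.lt_succ_self r) m hpt hp
  refine ⟨q, ?_, hpq⟩
  rw [← hs, Nat.add_sub_cancel_left]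
  exact hq
end

section
/- Let Q : A → A be an additive map satisfying the Cartan formula Q(x·y) = Q(x)·y² + x²·Q(y) for all x, y ∈ A, and suppose Q(ζ_j) = ζ_{j+1} for all j ≥ 1. Then Q(ξ_j) = ξ_{j+1} + ξ₁·ξ_j² for all j ≥ 1. -/
open MvPolynomial

theorem zeta_succ (n : ℕ) :
    zeta (n + 1) = ∑ i ∈ Finset.range (n + 1), (X i) ^ (2 ^ (n - i)) * zeta (n - i) := by
  rw [zeta]

theorem zeta_one : zeta 1 = X 0 := by
  simp [zeta_succ, zeta]

theorem cartan_sq {R : Type*} [CommRing R] [CharP R 2] {Q : R → R}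
    (hcartan : ∀ x y, Q (x * y) = Q x * y ^ 2 + x ^ 2 * Q y) (x : R) : Q (x ^ 2) = 0 := by
  rw [sq, hcartan, mul_comm (x ^ 2), CharTwo.add_self_eq_zero]

/-- STATEMENT 13: If `Q : A → A` is additive, satisfies the Cartan formula
`Q(xy) = Q(x)y² + x²Q(y)`, and `Q(ζ_j) = ζ_{j+1}` for all `j ≥ 1`, then
`Q(ξ_j) = ξ_{j+1} + ξ₁ξ_j²` for all `j ≥ 1`.  (The variable `X (j-1)`
represents `ξ_j`.) -/
theorem Q_on_xi (Q : DualSteenrod → DualSteenrod)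
    (hadd : ∀ x y, Q (x + y) = Q x + Q y)
    (hcartan : ∀ x y, Q (x * y) = Q x * y ^ 2 + x ^ 2 * Q y)
    (hzeta : ∀ j, 1 ≤ j → Q (zeta j) = zeta (j + 1)) :
    ∀ j, 1 ≤ j → Q (X (j - 1)) = X j + X 0 * (X (j - 1)) ^ 2 := by
  rintro (_ | n) hj
  · omega
  have hterm : ∀ i ∈ Finset.range n, Q (X i ^ 2 ^ (n - i) * zeta (n - i)) =
      X i ^ 2 ^ (n + 1 - i) * zeta (n + 1 - i) := by
    intro i hi
    obtain ⟨d, rfl⟩ := Nat.exists_eq_add_of_lt (Finset.mem_range.mp hi)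
    rw [show i + d + 1 - i = d + 1 by omega, show i + d + 1 + 1 - i = d + 1 + 1 by omega,
      hcartan, hzeta _ (Nat.succ_pos d), pow_succ 2 d, pow_mul, cartan_sq hcartan]
    ring
  have hsum : Q (zeta (n + 1)) =
      ∑ i ∈ Finset.range n, X i ^ 2 ^ (n + 1 - i) * zeta (n + 1 - i) + Q (X n) := by
    rw [zeta_succ, ← AddMonoidHom.mk'_apply (f := Q) hadd, map_sum, Finset.sum_range_succ]
    simp only [AddMonoidHom.mk'_apply]
    rw [Finset.sum_congr rfl hterm]
    simp [zeta]
  rw [hzeta _ hj, zeta_succ, Finset.sum_range_succ, Finset.sum_range_succ] at hsum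
  simp only [Nat.sub_self, Nat.add_sub_cancel_left, pow_zero, pow_one, zeta_one, add_assoc,
    add_right_inj] at hsum
  rw [Nat.add_sub_cancel, ← hsum]
  simp [zeta]
  ring
end

section
/- In the polynomial ring F₂[ξ₁, ξ₂], where ζ̄₃ = ξ₁⁷ + ξ₁⁴ξ₂ + ξ₁ξ₂² and ζ̄₄ = ξ₁¹⁵ + ξ₁¹²ξ₂ + ξ₁⁹ξ₂² + ξ₁³ξ₂⁴ + ξ₂⁵ are the images of the conjugate classes ζ₃ and ζ₄, the element ξ₁¹⁶ lies in the ideal generated by ζ̄₃ and ζ̄₄. -/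
open MvPolynomial

/-- The explicit form of `ζ̄₃` in `A⟨2⟩`. -/
theorem zetaBar_two_three :
    zetaBar 2 3 = X 0 ^ 7 + X 0 ^ 4 * X 1 + X 0 * X 1 ^ 2 := by
  simp [zetaBar, zeta, proj, Finset.sum_range_succ]
  ring

/-- The explicit form of `ζ̄₄` in `A⟨2⟩`. -/
theorem zetaBar_two_four :
    zetaBar 2 4 =
      X 0 ^ 15 + X 0 ^ 12 * X 1 + X 0 ^ 9 * X 1 ^ 2 + X 0 ^ 3 * X 1 ^ 4 + X 1 ^ 5 := by
  simp [zetaBar, zeta, proj, Finset.sum_range_succ]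
  ring

/-- STATEMENT 14: In `F₂[ξ₁, ξ₂]` (where `X 0 = ξ₁`, `X 1 = ξ₂`), with
`ζ̄₃ = ξ₁⁷ + ξ₁⁴ξ₂ + ξ₁ξ₂²` and `ζ̄₄ = ξ₁¹⁵ + ξ₁¹²ξ₂ + ξ₁⁹ξ₂² + ξ₁³ξ₂⁴ + ξ₂⁵`,
the element `ξ₁¹⁶` lies in the ideal `(ζ̄₃, ζ̄₄)`. -/
theorem xi1_pow16_mem (z3 z4 : MvPolynomial (Fin 2) (ZMod 2))
    (h3 : z3 = zetaBar 2 3) (h4 : z4 = zetaBar 2 4) :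
    z3 = X 0 ^ 7 + X 0 ^ 4 * X 1 + X 0 * X 1 ^ 2 ∧
    z4 = X 0 ^ 15 + X 0 ^ 12 * X 1 + X 0 ^ 9 * X 1 ^ 2 + X 0 ^ 3 * X 1 ^ 4 + X 1 ^ 5 ∧
    (X 0 : MvPolynomial (Fin 2) (ZMod 2)) ^ 16 ∈ Ideal.span {z3, z4} := by
  subst h3 h4
  refine ⟨zetaBar_two_three, zetaBar_two_four, ?_⟩
  rw [zetaBar_two_three, zetaBar_two_four, Ideal.mem_span_pair]
  refine ⟨X 0 ^ 6 * X 1 + X 1 ^ 3, X 0, ?_⟩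
  have two_eq_zero : (2 : MvPolynomial (Fin 2) (ZMod 2)) = 0 := CharTwo.two_eq_zero
  linear_combination (X 0 ^ 13 * X 1 + X 0 ^ 10 * X 1 ^ 2 + X 0 ^ 7 * X 1 ^ 3 +
    X 0 ^ 4 * X 1 ^ 4 + X 0 * X 1 ^ 5) * two_eq_zero
end

section
/- For every natural number d, the F₂-dimension of the weighted-degree-d component of F₂[ξ₁, ξ₂]/(ζ̄₃, ζ̄₄) equals the F₂-dimension of the weighted-degree-d component of F₂[ξ₁, ξ₂]/(ξ₁ξ₂², ξ₂⁵, ξ₁¹⁶), where the weighted-degree-d component of a quotient by a homogeneous ideal I means H_d/(H_d ∩ I) with H_d the space of weighted-homogeneous polynomials of degree d. In particular, both quotient rings have total F₂-dimension 35. -/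
open MvPolynomial

/-- If the monomials with exponent in `S` are linearly independent modulo `I` and every monomial
with exponent in `D` reduces modulo `I` to those with exponent in `S ∩ D`, then the image in the
quotient of the polynomials supported on `D` has dimension the cardinality of `S ∩ D`. -/
theorem finrank_map_restrictSupport {σ K : Type*} [Field K] (I : Ideal (MvPolynomial σ K))
    (S D : Set (σ →₀ ℕ)) (hindep : ∀ p ∈ I, p ∈ restrictSupport K S → p = 0)
    (hspan : ∀ m ∈ D,
      monomial m 1 ∈ I.restrictScalars K ⊔ restrictSupport K (S ∩ D)) :
    Module.finrank K ((restrictSupport K D).map (Ideal.Quotient.mkₐ K I).toLinearMap) =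
      (S ∩ D).ncard := by
  set f := (Ideal.Quotient.mkₐ K I).toLinearMap with hf
  have hker : ∀ p, f p = 0 ↔ p ∈ I := fun p => Ideal.Quotient.eq_zero_iff_mem
  have hkerI : LinearMap.ker f = I.restrictScalars K := by
    ext p
    exact hker p
  have hmap : (restrictSupport K D).map f = (restrictSupport K (S ∩ D)).map f := by
    apply le_antisymm
    · rw [Submodule.map_le_iff_le_comap, Submodule.comap_map_eq, hkerI, sup_comm,
        restrictSupport_eq_span K D, Submodule.span_le]
      rintro _ ⟨m, hm, rfl⟩
      exact hspan m hm
    · exact Submodule.map_mono (restrictSupport_mono K Set.inter_subset_right)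
  have hinj : Function.Injective (f.domRestrict (restrictSupport K (S ∩ D))) := by
    rw [injective_iff_map_eq_zero]
    rintro ⟨p, hp⟩ h
    exact Subtype.ext (hindep p ((hker p).1 h) (restrictSupport_mono K Set.inter_subset_left hp))
  rw [hmap, ← LinearMap.range_domRestrict, LinearMap.finrank_range_of_inj hinj,
    Module.finrank_eq_nat_card_basis (basisRestrictSupport K (S ∩ D)), Set.ncard]
  rfl

theorem monomial_single_add_single (a b : ℕ) :
    (monomial (Finsupp.single 0 a + Finsupp.single 1 b) 1 : MvPolynomial (Fin 2) (ZMod 2)) =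
      X 0 ^ a * X 1 ^ b := by
  simp [X_pow_eq_monomial, monomial_mul]

theorem monomial_fin_two (m : Fin 2 →₀ ℕ) :
    (monomial m 1 : MvPolynomial (Fin 2) (ZMod 2)) = X 0 ^ m 0 * X 1 ^ m 1 := by
  rw [monomial_eq, Finsupp.prod_fintype _ _ (by simp)]
  simp

theorem weight_one_three (m : Fin 2 →₀ ℕ) : Finsupp.weight ![1, 3] m = m 0 + 3 * m 1 := by
  rw [Finsupp.weight_apply, Finsupp.sum_fintype _ _ (by simp)]
  simp [mul_comm]

/-- The exponents of the monomials outside the ideal `(ξ₁ξ₂², ξ₂⁵, ξ₁¹⁶)`. -/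
def standardExponents : Set (Fin 2 →₀ ℕ) :=
  {m | (m 0 < 16 ∧ m 1 < 2) ∨ (m 0 = 0 ∧ m 1 < 5)}

theorem ncard_standardExponents : standardExponents.ncard = 35 := by
  let e : ℕ × ℕ → (Fin 2 →₀ ℕ) := fun x => Finsupp.single 0 x.1 + Finsupp.single 1 x.2
  have he0 : ∀ x, e x 0 = x.1 := fun x => by simp [e]
  have he1 : ∀ x, e x 1 = x.2 := fun x => by simp [e]
  have he : Function.Injective e := fun x y h =>
    Prod.ext (by rw [← he0 x, h, he0]) (by rw [← he1 x, h, he1])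
  let T : Finset (ℕ × ℕ) := Finset.range 16 ×ˢ Finset.range 2 ∪ {0} ×ˢ Finset.range 5
  have hT : standardExponents = e '' T := by
    ext m
    constructor
    · intro h
      refine ⟨(m 0, m 1), ?_, ?_⟩
      · have h' : (m 0 < 16 ∧ m 1 < 2) ∨ (m 0 = 0 ∧ m 1 < 5) := h
        simpa only [T, Finset.coe_union, Set.mem_union, Finset.mem_coe, Finset.mem_product,
          Finset.mem_range, Finset.mem_singleton] using h'
      ext i
      fin_cases i
      · exact he0 _
      · exact he1 _
    · rintro ⟨x, hx, rfl⟩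
      simp only [T, Finset.coe_union, Set.mem_union, Finset.mem_coe, Finset.mem_product,
        Finset.mem_range, Finset.mem_singleton] at hx
      rwa [standardExponents, Set.mem_ofPred_eq, he0, he1]
  rw [hT, Set.ncard_image_of_injective _ he, Set.ncard_coe_finset]
  decide

/-- An ideal whose initial ideal is `(ξ₁ξ₂², ξ₂⁵, ξ₁¹⁶)`, in a way compatible with weights `1, 3`,
has quotient of dimension `35`, with graded pieces counted by the standard exponents. -/
theorem finrank_quotient_of_standardExponents (I : Ideal (MvPolynomial (Fin 2) (ZMod 2)))
    (hindep : ∀ p ∈ I, p ∈ restrictSupport (ZMod 2) standardExponents → p = 0)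
    (hspan : ∀ (N : Submodule (ZMod 2) (MvPolynomial (Fin 2) (ZMod 2))) (d : ℕ),
      I.restrictScalars (ZMod 2) ≤ N →
      (∀ a b, a + 3 * b = d → (a < 16 ∧ b < 2) ∨ (a = 0 ∧ b < 5) → X 0 ^ a * X 1 ^ b ∈ N) →
      ∀ b a, a + 3 * b = d → X 0 ^ a * X 1 ^ b ∈ N) :
    (∀ d, Module.finrank (ZMod 2) ((weightedHomogeneousSubmodule (ZMod 2) ![1, 3] d).map
        (Ideal.Quotient.mkₐ (ZMod 2) I).toLinearMap) =
          (standardExponents ∩ {m | Finsupp.weight ![1, 3] m = d}).ncard) ∧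
      Module.finrank (ZMod 2) (MvPolynomial (Fin 2) (ZMod 2) ⧸ I) = 35 := by
  have hred : ∀ (d : ℕ) (m : Fin 2 →₀ ℕ), Finsupp.weight ![1, 3] m = d →
      monomial m 1 ∈ I.restrictScalars (ZMod 2) ⊔
        restrictSupport (ZMod 2) (standardExponents ∩ {m | Finsupp.weight ![1, 3] m = d}) := by
    intro d m hm
    rw [monomial_fin_two]
    refine hspan _ d le_sup_left (fun a b hd hab => ?_) _ _ (by rw [← hm, weight_one_three])
    refine Submodule.mem_sup_right ?_
    rw [← monomial_single_add_single, monomial_mem_restrictSupport]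
    left
    refine ⟨by simpa [standardExponents] using hab, ?_⟩
    rw [Set.mem_ofPred_eq, weight_one_three]
    simpa using hd
  constructor
  · intro d
    rw [weightedHomogeneousSubmodule_eq_finsupp_supported]
    exact finrank_map_restrictSupport I _ _ hindep (hred d)
  · have h := finrank_map_restrictSupport I standardExponents Set.univ hindep fun m _ =>
      sup_le_sup_left (restrictSupport_mono _ (Set.inter_subset_inter_right _
        (Set.subset_univ _))) (I.restrictScalars (ZMod 2)) (hred _ m rfl)
    have hsurj : LinearMap.range (Ideal.Quotient.mkₐ (ZMod 2) I).toLinearMap = ⊤ :=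
      LinearMap.range_eq_top.2 Ideal.Quotient.mk_surjective
    rwa [restrictSupport_univ, Submodule.map_top, hsurj, finrank_top, Set.inter_univ,
      ncard_standardExponents] at h

/-- The embedding of `F₂[ξ₁, ξ₂]` in `F₂[ξ₁][ξ₂]`. -/
noncomputable def toBivariate :
    MvPolynomial (Fin 2) (ZMod 2) →ₐ[ZMod 2] Polynomial (Polynomial (ZMod 2)) :=
  aeval ![Polynomial.C Polynomial.X, Polynomial.X]

theorem coeff_coeff_toBivariate (p : MvPolynomial (Fin 2) (ZMod 2)) (m : Fin 2 →₀ ℕ) :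
    ((toBivariate p).coeff (m 1)).coeff (m 0) = coeff m p := by
  induction p using MvPolynomial.induction_on' with
  | add p q hp hq => simp [hp, hq]
  | monomial n r =>
    have hr : monomial n r = r • (monomial n 1 : MvPolynomial (Fin 2) (ZMod 2)) := by
      simp [smul_monomial]
    have hmn : n = m ↔ m 0 = n 0 ∧ m 1 = n 1 := by
      rw [eq_comm, Finsupp.ext_iff, Fin.forall_fin_two]
    rw [hr, map_smul, coeff_smul, coeff_monomial, monomial_fin_two]
    simp only [toBivariate, map_mul, map_pow, aeval_X, Matrix.cons_val_zero, Matrix.cons_val_one]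
    rw [← Polynomial.C_pow]
    simp only [Polynomial.coeff_smul, Polynomial.coeff_C_mul, Polynomial.coeff_X_pow,
      hmn]
    by_cases h1 : m 1 = n 1 <;> by_cases h0 : m 0 = n 0 <;>
      simp [h1, h0, Polynomial.coeff_X_pow]

section Bivariate

local notation "ξ" => (Polynomial.X : Polynomial (ZMod 2))
local notation "η" => (Polynomial.X : Polynomial (Polynomial (ZMod 2)))

/-- Modulo the monic polynomial `q = η² + ξ³η + ξ⁶`, the second generator is `ξ¹⁵`, while the first
one is `ξq`; this is what makes the standard monomials independent. -/
theorem bivariate_eq_zero (P a b : Polynomial (Polynomial (ZMod 2)))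
    (hP : P = a * (Polynomial.C ξ ^ 7 + Polynomial.C ξ ^ 4 * η + Polynomial.C ξ * η ^ 2) +
      b * (Polynomial.C ξ ^ 15 + Polynomial.C ξ ^ 12 * η + Polynomial.C ξ ^ 9 * η ^ 2 +
        Polynomial.C ξ ^ 3 * η ^ 4 + η ^ 5))
    (hS : ∀ i j, (P.coeff j).coeff i ≠ 0 → (i < 16 ∧ j < 2) ∨ (i = 0 ∧ j < 5)) : P = 0 := by
  have h2 : (2 : Polynomial (Polynomial (ZMod 2))) = 0 := CharTwo.two_eq_zero
  have hb : Polynomial.C ξ ∣ b := by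
    rw [Polynomial.C_dvd_iff_dvd_coeff]
    intro j
    rw [Polynomial.X_dvd_iff]
    have h := congrArg (Polynomial.map (Polynomial.evalRingHom 0)) hP
    simp only [Polynomial.map_add, Polynomial.map_mul, Polynomial.map_pow, Polynomial.map_C,
      Polynomial.map_X, Polynomial.coe_evalRingHom, Polynomial.eval_X, map_zero] at h
    have h' := congrArg (fun Q => Polynomial.coeff Q (j + 5)) h
    simp [Polynomial.coeff_mul_X_pow, ← Polynomial.coeff_zero_eq_eval_zero] at h'
    rw [← h']
    by_contra h0
    have := hS _ _ h0
    omega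
  obtain ⟨b', rfl⟩ := hb
  set q : Polynomial (Polynomial (ZMod 2)) :=
    η ^ 2 + (Polynomial.C (ξ ^ 3) * η + Polynomial.C (ξ ^ 6)) with hq
  have hdeg : (Polynomial.C (ξ ^ 3) * η + Polynomial.C (ξ ^ 6)).degree < (2 : ℕ) :=
    Polynomial.degree_linear_lt
  have hqm : q.Monic := Polynomial.monic_X_pow_add hdeg
  have hqd : q.degree = (2 : ℕ) := by
    rw [hq, Polynomial.degree_add_eq_left_of_degree_lt] <;> rw [Polynomial.degree_X_pow]
    exact hdeg
  obtain ⟨Q, hQ⟩ : ∃ Q, Q = q * (a + b' * (η ^ 3 + Polynomial.C ξ ^ 6 * η)) + ξ ^ 15 • b' := ⟨_, rfl⟩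
  have hPQ : P = Polynomial.C ξ * Q := by
    rw [hP, hQ, hq, Polynomial.smul_eq_C_mul]
    simp only [map_pow]
    linear_combination -(Polynomial.C ξ ^ 7 * b' * η ^ 3) * h2
  have hQS : ∀ i j, (Q.coeff j).coeff i ≠ 0 → i < 15 ∧ j < 2 := by
    intro i j h
    have := hS (i + 1) j (by rwa [hPQ, Polynomial.coeff_C_mul, Polynomial.coeff_X_mul])
    omega
  have hQd : Q %ₘ q = Q := by
    rw [Polynomial.modByMonic_eq_self_iff hqm, hqd, Polynomial.degree_lt_iff_coeff_zero]
    intro j hj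
    ext i
    by_contra h
    have := hQS i j h
    omega
  have hmod : Q = ξ ^ 15 • (b' %ₘ q) := by
    rw [← hQd]
    conv_lhs => rw [hQ]
    rw [Polynomial.add_modByMonic, Polynomial.self_mul_modByMonic hqm, zero_add,
      Polynomial.smul_modByMonic]
  suffices h : Q = 0 by rw [hPQ, h, mul_zero]
  ext j i
  by_contra h
  have hi := (hQS i j h).1
  apply h
  rw [hmod, Polynomial.coeff_smul, smul_eq_mul, Polynomial.coeff_X_pow_mul', if_neg (by omega)]
  rfl

end Bivariate

theorem eq_zero_of_mem_span_zetaBar (p : MvPolynomial (Fin 2) (ZMod 2))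
    (hp : p ∈ Ideal.span {zetaBar 2 3, zetaBar 2 4})
    (hS : p ∈ restrictSupport (ZMod 2) standardExponents) : p = 0 := by
  obtain ⟨a, b, hab⟩ := Ideal.mem_span_pair.1 hp
  have hcoeff : ∀ i j, ((toBivariate p).coeff j).coeff i =
      coeff (Finsupp.single 0 i + Finsupp.single 1 j) p := fun i j => by
    rw [← coeff_coeff_toBivariate]
    simp
  have h0 : toBivariate p = 0 := by
    refine bivariate_eq_zero _ (toBivariate a) (toBivariate b) ?_ fun i j h => ?_
    · rw [← hab, zetaBar_two_three, zetaBar_two_four]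
      simp [toBivariate]
    · rw [hcoeff] at h
      simpa [standardExponents] using hS (mem_support_iff.2 h)
  ext m
  rw [← coeff_coeff_toBivariate, h0]
  simp

theorem monomial_mem_of_span_zetaBar_le (N : Submodule (ZMod 2) (MvPolynomial (Fin 2) (ZMod 2)))
    (d : ℕ) (hI : (Ideal.span {zetaBar 2 3, zetaBar 2 4}).restrictScalars (ZMod 2) ≤ N)
    (hN : ∀ a b, a + 3 * b = d → (a < 16 ∧ b < 2) ∨ (a = 0 ∧ b < 5) → X 0 ^ a * X 1 ^ b ∈ N)
    (b a : ℕ) (hd : a + 3 * b = d) : X 0 ^ a * X 1 ^ b ∈ N := by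
  have h2 : (2 : MvPolynomial (Fin 2) (ZMod 2)) = 0 := CharTwo.two_eq_zero
  have hmem : ∀ u v, u * zetaBar 2 3 + v * zetaBar 2 4 ∈ N := fun u v =>
    hI (Ideal.mem_span_pair.2 ⟨u, v, rfl⟩)
  rw [zetaBar_two_three, zetaBar_two_four] at hmem
  induction b using Nat.strong_induction_on generalizing a with
  | _ b ih =>
    by_cases hab : (a < 16 ∧ b < 2) ∨ (a = 0 ∧ b < 5)
    · exact hN a b hd hab
    by_cases hb : b < 2
    · obtain ⟨k, rfl⟩ := Nat.exists_eq_add_of_le (show 16 ≤ a by omega)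
      convert hmem (X 0 ^ k * X 1 ^ b * (X 1 ^ 3 + X 0 ^ 6 * X 1)) (X 0 ^ k * X 1 ^ b * X 0) using 1
      rw [pow_add]
      grind
    by_cases ha : a = 0
    · obtain ⟨k, rfl⟩ := Nat.exists_eq_add_of_le (show 5 ≤ b by omega)
      have h := N.add_mem (N.add_mem (N.add_mem (N.add_mem (hmem 0 (X 1 ^ k))
        (ih k (by omega) 15 (by omega))) (ih (k + 1) (by omega) 12 (by omega)))
        (ih (k + 2) (by omega) 9 (by omega))) (ih (k + 4) (by omega) 3 (by omega))
      convert h using 1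
      subst ha
      ring_nf
      grind
    · obtain ⟨k, rfl⟩ := Nat.exists_eq_add_of_le (show 2 ≤ b by omega)
      obtain ⟨l, rfl⟩ := Nat.exists_eq_add_of_le (show 1 ≤ a by omega)
      have h := N.add_mem (N.add_mem (hmem (X 0 ^ l * X 1 ^ k) 0)
        (ih k (by omega) (l + 7) (by omega))) (ih (k + 1) (by omega) (l + 4) (by omega))
      convert h using 1
      ring_nf
      grind

theorem span_monomials_eq : (Ideal.span {X 0 * X 1 ^ 2, X 1 ^ 5, X 0 ^ 16} :
    Ideal (MvPolynomial (Fin 2) (ZMod 2))) = Ideal.span ((fun s => monomial s 1) ''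
      {Finsupp.single 0 1 + Finsupp.single 1 2, Finsupp.single 0 0 + Finsupp.single 1 5,
        Finsupp.single 0 16 + Finsupp.single 1 0}) := by
  simp only [Set.image_insert_eq, Set.image_singleton, monomial_single_add_single]
  simp

theorem mem_span_monomials_iff (p : MvPolynomial (Fin 2) (ZMod 2)) :
    p ∈ Ideal.span {X 0 * X 1 ^ 2, X 1 ^ 5, X 0 ^ 16} ↔
      ∀ m ∈ p.support, m ∉ standardExponents := by
  rw [span_monomials_eq, mem_ideal_span_monomial_image]
  refine forall₂_congr fun m _ => ?_
  simp [standardExponents, Finsupp.le_def, Fin.forall_fin_two]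
  omega

theorem eq_zero_of_mem_span_monomials (p : MvPolynomial (Fin 2) (ZMod 2))
    (hp : p ∈ Ideal.span {X 0 * X 1 ^ 2, X 1 ^ 5, X 0 ^ 16})
    (hS : p ∈ restrictSupport (ZMod 2) standardExponents) : p = 0 := by
  rw [mem_span_monomials_iff] at hp
  rw [← support_eq_empty]
  exact Finset.eq_empty_of_forall_notMem fun m hm => hp m hm (hS hm)

theorem monomial_mem_of_span_monomials_le
    (N : Submodule (ZMod 2) (MvPolynomial (Fin 2) (ZMod 2))) (d : ℕ)
    (hI : (Ideal.span {X 0 * X 1 ^ 2, X 1 ^ 5, X 0 ^ 16}).restrictScalars (ZMod 2) ≤ N)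
    (hN : ∀ a b, a + 3 * b = d → (a < 16 ∧ b < 2) ∨ (a = 0 ∧ b < 5) → X 0 ^ a * X 1 ^ b ∈ N)
    (b a : ℕ) (hd : a + 3 * b = d) : X 0 ^ a * X 1 ^ b ∈ N := by
  by_cases hab : (a < 16 ∧ b < 2) ∨ (a = 0 ∧ b < 5)
  · exact hN a b hd hab
  refine hI ((mem_span_monomials_iff _).2 fun m hm => ?_)
  rw [← monomial_single_add_single] at hm
  rw [Finset.mem_singleton.1 (support_monomial_subset hm)]
  simpa [standardExponents] using hab

/-- STATEMENT 17: In `F₂[ξ₁, ξ₂]` graded with `ξ₁` of weight `1` and `ξ₂` of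
weight `3`, the quotients by `(ζ̄₃, ζ̄₄)` and by `(ξ₁ξ₂², ξ₂⁵, ξ₁¹⁶)` have the
same dimension in each weighted degree, and both have total `F₂`-dimension 35. -/
theorem dim_quotients_agree (w : Fin 2 → ℕ) (hw : w = ![1, 3])
    (I₁ I₂ : Ideal (MvPolynomial (Fin 2) (ZMod 2)))
    (hI₁ : I₁ = Ideal.span {zetaBar 2 3, zetaBar 2 4})
    (hI₂ : I₂ = Ideal.span {X 0 * X 1 ^ 2, X 1 ^ 5, X 0 ^ 16}) :
    (∀ d : ℕ,
      Module.finrank (ZMod 2)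
        ((MvPolynomial.weightedHomogeneousSubmodule (ZMod 2) w d).map
          (Ideal.Quotient.mkₐ (ZMod 2) I₁).toLinearMap) =
      Module.finrank (ZMod 2)
        ((MvPolynomial.weightedHomogeneousSubmodule (ZMod 2) w d).map
          (Ideal.Quotient.mkₐ (ZMod 2) I₂).toLinearMap)) ∧
    Module.finrank (ZMod 2) (MvPolynomial (Fin 2) (ZMod 2) ⧸ I₁) = 35 ∧
    Module.finrank (ZMod 2) (MvPolynomial (Fin 2) (ZMod 2) ⧸ I₂) = 35 := by
  subst hw hI₁ hI₂
  obtain ⟨h₁, h₁'⟩ := finrank_quotient_of_standardExponents _ eq_zero_of_mem_span_zetaBar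
    monomial_mem_of_span_zetaBar_le
  obtain ⟨h₂, h₂'⟩ := finrank_quotient_of_standardExponents _ eq_zero_of_mem_span_monomials
    monomial_mem_of_span_monomials_le
  exact ⟨fun d => (h₁ d).trans (h₂ d).symm, h₁', h₂'⟩
end
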